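/- Let P be the Pell sequence (P_0 = 0, P_1 = 1, P_n = 2P_{n-1} + P_{n-2}), Q the associated Pell sequence (Q_0 = 1, Q_1 = 1, Q_n = 2Q_{n-1} + Q_{n-2}), and B the balancing sequence (B_0 = 0, B_1 = 1, B_n = 6B_{n-1} − B_{n-2}). Define σ_B(k,n) = Σ_{i=1}^{k} B_{n+i}. For all k ≥ 1 and all n ≥ 0: 4·σ_B(k,n) = P_{2k+2n+1} − P_{2n+1}; moreover if k is even then 2·σ_B(k,n) = P_k·Q_{k+2n+1}, and if k is odd then 2·σ_B(k,n) = Q_k·P_{k+2n+1}. -/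

import Mathlib

/-- The Pell sequence: P₀ = 0, P₁ = 1, Pₙ = 2Pₙ₋₁ + Pₙ₋₂. -/
def pell : ℕ → ℤ
  | 0 => 0
  | 1 => 1
  | n + 2 => 2 * pell (n + 1) + pell n

/-- The associated Pell sequence: Q₀ = 1, Q₁ = 1, Qₙ = 2Qₙ₋₁ + Qₙ₋₂. -/
def assocPell : ℕ → ℤ
  | 0 => 1
  | 1 => 1
  | n + 2 => 2 * assocPell (n + 1) + assocPell n

/-- The balancing sequence: B₀ = 0, B₁ = 1, Bₙ = 6Bₙ₋₁ − Bₙ₋₂. -/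
def balancing : ℕ → ℤ
  | 0 => 0
  | 1 => 1
  | n + 2 => 6 * balancing (n + 1) - balancing n

theorem pell_succ_and_assocPell_succ (n : ℕ) :
    pell (n + 1) = pell n + assocPell n ∧ assocPell (n + 1) = 2 * pell n + assocPell n := by
  induction n with
  | zero => simp [pell, assocPell]
  | succ n ih =>
    rw [pell, assocPell]
    constructor <;> linarith [ih.1, ih.2]

theorem pell_succ (n : ℕ) : pell (n + 1) = pell n + assocPell n :=
  (pell_succ_and_assocPell_succ n).1

theorem assocPell_succ (n : ℕ) : assocPell (n + 1) = 2 * pell n + assocPell n :=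
  (pell_succ_and_assocPell_succ n).2

theorem pell_add_and_assocPell_add (m k : ℕ) :
    pell (m + k) = pell m * assocPell k + assocPell m * pell k ∧
      assocPell (m + k) = assocPell m * assocPell k + 2 * pell m * pell k := by
  induction k with
  | zero => simp [pell, assocPell]
  | succ k ih =>
    rw [← add_assoc, pell_succ, assocPell_succ, pell_succ, assocPell_succ, ih.1, ih.2]
    constructor <;> ring

theorem pell_add (m k : ℕ) : pell (m + k) = pell m * assocPell k + assocPell m * pell k :=
  (pell_add_and_assocPell_add m k).1

theorem pell_add_mul_assocPell_sub (m k : ℕ) :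
    pell (m + k) * assocPell k - assocPell (m + k) * pell k = (-1) ^ k * pell m := by
  induction k with
  | zero => simp [pell, assocPell]
  | succ k ih =>
    rw [← add_assoc, pell_succ, assocPell_succ, pell_succ, assocPell_succ, pow_succ]
    linear_combination -ih

theorem two_mul_balancing (n : ℕ) : 2 * balancing n = pell (2 * n) := by
  induction n using Nat.twoStepInduction with
  | zero => simp [pell, balancing]
  | one => simp [pell, balancing]
  | more n ih ih' =>
    have h : pell (2 * (n + 2)) = 6 * pell (2 * (n + 1)) - pell (2 * n) := by
      simp only [mul_add, mul_one, Nat.reduceMul, pell]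
      ring
    rw [balancing, h, ← ih, ← ih']
    ring

theorem four_mul_sum_balancing (k n : ℕ) :
    4 * (∑ i ∈ Finset.Icc 1 k, balancing (n + i)) =
      pell (2 * k + 2 * n + 1) - pell (2 * n + 1) := by
  induction k with
  | zero => simp
  | succ k ih =>
    rw [Finset.sum_Icc_succ_top (by omega), mul_add, ih]
    have hb := two_mul_balancing (n + (k + 1))
    rw [show 2 * (n + (k + 1)) = 2 * k + 2 * n + 2 by ring] at hb
    rw [show 2 * (k + 1) + 2 * n + 1 = 2 * k + 2 * n + 1 + 2 by ring, pell]
    linarith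

theorem sigma_balancing (k n : ℕ) (hk : 1 ≤ k) :
    4 * (∑ i ∈ Finset.Icc 1 k, balancing (n + i)) = pell (2 * k + 2 * n + 1) - pell (2 * n + 1) ∧
    (Even k →
      2 * (∑ i ∈ Finset.Icc 1 k, balancing (n + i)) = pell k * assocPell (k + 2 * n + 1)) ∧
    (Odd k →
      2 * (∑ i ∈ Finset.Icc 1 k, balancing (n + i)) = assocPell k * pell (k + 2 * n + 1)) := by
  have h4 := four_mul_sum_balancing k n
  have hadd := pell_add (2 * n + 1 + k) k
  have hsub := pell_add_mul_assocPell_sub (2 * n + 1) k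
  rw [show 2 * n + 1 + k + k = 2 * k + 2 * n + 1 by ring] at hadd
  rw [show 2 * n + 1 + k = k + 2 * n + 1 by ring] at hadd hsub
  refine ⟨h4, fun he => ?_, fun ho => ?_⟩
  · rw [he.neg_one_pow] at hsub
    linarith
  · rw [ho.neg_one_pow] at hsub
    linarith
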